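/- Let r ∈ (1,∞), r' = r/(r−1), and k ∈ (0,1). Then (π_{r'r}/2)·(sin_r^{−1}(k)/k) ≤ K_{r'r}(k) ≤ (π_{r'r}/2)·(tanh_r^{−1}(k)/k) ≤ (π_{r'r}/2)·(1−k^r)^{−1/r}, where K_{r'r}(k) = ∫₀¹ (1−t^r)^{−1/r'}·(1−k^r t^r)^{−1/r} dt, π_{r'r} = 2∫₀¹ (1−t^r)^{−1/r'} dt, sin_r^{−1}(k) = ∫₀^k (1−s^r)^{−1/r} ds, and tanh_r^{−1}(k) = ∫₀^k (1−s^r)^{−1} ds. -/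

import Mathlib

open Real intervalIntegral

/-- `K_{r'r}(k) = ∫₀¹ (1−t^r)^{−1/r'}(1−k^r t^r)^{−1/r} dt` with `r' = r/(r−1)`. -/
noncomputable def Krr (r k : ℝ) : ℝ :=
  ∫ t in (0:ℝ)..1, (1 - t ^ r) ^ (-(1 / (r / (r - 1)))) * (1 - k ^ r * t ^ r) ^ (-(1 / r))

/-- `π_{r'r} = 2∫₀¹ (1−t^r)^{−1/r'} dt` with `r' = r/(r−1)`. -/
noncomputable def piRR (r : ℝ) : ℝ :=
  2 * ∫ t in (0:ℝ)..1, (1 - t ^ r) ^ (-(1 / (r / (r - 1))))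

/-- The generalized inverse sine `sin_r^{−1}(x) = ∫₀^x (1−s^r)^{−1/r} ds`. -/
noncomputable def arcsinR (r x : ℝ) : ℝ := ∫ s in (0:ℝ)..x, (1 - s ^ r) ^ (-(1 / r))

/-- The generalized inverse hyperbolic tangent `tanh_r^{−1}(x) = ∫₀^x (1−s^r)^{−1} ds`. -/
noncomputable def artanhR (r x : ℝ) : ℝ := ∫ s in (0:ℝ)..x, (1 - s ^ r)⁻¹

open MeasureTheory Set in
/-- Termwise integration of a power series with nonnegative coefficients, composed with
`t ↦ x * t ^ r`, against an integrable weight `v` on `[0, 1]`. -/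
lemma hasSum_integral_weight_mul_powerSeries {r x : ℝ} (hr : 0 < r) (hx0 : 0 < x) (hx1 : x < 1)
    {v g : ℝ → ℝ} {d : ℕ → ℝ} (hd : ∀ n, 0 ≤ d n)
    (hg : ∀ y, 0 ≤ y → y < 1 → HasSum (fun n => d n * y ^ n) (g y))
    (hv : IntervalIntegrable v volume 0 1) :
    HasSum (fun n => d n * x ^ n * ∫ t in (0:ℝ)..1, v t * (t ^ r) ^ n)
      (∫ t in (0:ℝ)..1, v t * g (x * t ^ r)) := by
  have hpow : ∀ t ∈ uIoc (0:ℝ) 1, 0 ≤ t ^ r ∧ t ^ r ≤ 1 := by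
    intro t ht
    rw [uIoc_of_le zero_le_one] at ht
    exact ⟨rpow_nonneg ht.1.le _, rpow_le_one ht.1.le ht.2 hr.le⟩
  have hsum := (hg x hx0.le hx1).summable
  simp only [← intervalIntegral.integral_const_mul]
  refine intervalIntegral.hasSum_integral_of_dominated_convergence
    (fun n t => |v t| * (d n * x ^ n)) (fun n => ?_) (fun n => ?_) ?_ ?_ ?_
  · have hcont : Continuous fun t : ℝ => (t ^ r) ^ n := (continuous_rpow_const hr.le).pow n
    exact ((intervalIntegrable_iff.1 hv).aestronglyMeasurable.mul hcont.aestronglyMeasurable).const_mul _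
  · refine ae_of_all _ fun t ht => ?_
    obtain ⟨h0, h1⟩ := hpow t ht
    have hdx : 0 ≤ d n * x ^ n := mul_nonneg (hd n) (pow_nonneg hx0.le n)
    rw [norm_mul _ (v t * _), norm_mul (v t), norm_of_nonneg hdx, norm_of_nonneg (pow_nonneg h0 n), norm_eq_abs,
      mul_comm (|v t|) (d n * x ^ n)]
    exact mul_le_mul_of_nonneg_left
      (mul_le_of_le_one_right (abs_nonneg _) (pow_le_one₀ h0 h1)) hdx
  · exact ae_of_all _ fun t _ => hsum.mul_left _
  · simp only [tsum_mul_left]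
    exact hv.abs.mul_const _
  · refine ae_of_all _ fun t ht => ?_
    obtain ⟨h0, h1⟩ := hpow t ht
    have h := (hg (x * t ^ r) (mul_nonneg hx0.le h0)
      ((mul_le_of_le_one_right hx0.le h1).trans_lt hx1)).mul_left (v t)
    simpa only [mul_pow, mul_assoc, mul_left_comm] using h

/-- The coefficients of the power series of `(1 - y) ^ (-a)` satisfy the binomial recursion. -/
lemma succ_mul_multichoose_succ (a : ℝ) (n : ℕ) :
    ((n : ℝ) + 1) * Ring.multichoose a (n + 1) = (a + n) * Ring.multichoose a n := by
  have h := Ring.factorial_nsmul_multichoose_eq_ascPochhammer a n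
  have h' := Ring.factorial_nsmul_multichoose_eq_ascPochhammer a (n + 1)
  rw [ascPochhammer_succ_right, Polynomial.smeval_mul, ← h] at h'
  simp [Nat.factorial_succ, Polynomial.smeval_add, Polynomial.smeval_X,
    Polynomial.smeval_natCast] at h'
  have hn : (n.factorial : ℝ) ≠ 0 := by exact_mod_cast n.factorial_ne_zero
  apply mul_left_cancel₀ hn
  linarith

lemma multichoose_nonneg_of_pos {a : ℝ} (ha : 0 < a) (n : ℕ) : 0 ≤ Ring.multichoose a n := by
  induction n with
  | zero => simp
  | succ n ih =>
    have h := succ_mul_multichoose_succ a n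
    have hn : (0:ℝ) < (n:ℝ) + 1 := by positivity
    have : 0 ≤ ((n : ℝ) + 1) * Ring.multichoose a (n + 1) := by rw [h]; positivity
    exact nonneg_of_mul_nonneg_right this hn

lemma hasSum_multichoose_mul_pow (a : ℝ) {y : ℝ} (hy0 : 0 ≤ y) (hy1 : y < 1) :
    HasSum (fun n => Ring.multichoose a n * y ^ n) ((1 - y) ^ (-a)) := by
  have h := (Real.one_div_one_sub_rpow_hasFPowerSeriesOnBall_zero a).hasSum (y := y)
    (by simpa [enorm_eq_nnnorm, ← NNReal.coe_lt_coe, abs_of_nonneg hy0] using hy1)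
  simp only [zero_add, FormalMultilinearSeries.ofScalars_apply_eq,
    ← Ring.multichoose_eq, smul_eq_mul] at h
  rwa [rpow_neg (by linarith), ← one_div]

lemma one_le_mul_multichoose {r : ℝ} (hr : 1 < r) (n : ℕ) :
    1 ≤ (r * n + 1) * Ring.multichoose (1 / r) n := by
  induction n with
  | zero => simp
  | succ n ih =>
    have h := succ_mul_multichoose_succ (1 / r) n
    have hr0 : 0 < r := by linarith
    have hc := multichoose_nonneg_of_pos (a := 1 / r) (by positivity) (n + 1)
    have hrec : (r * (n + 1)) * Ring.multichoose (1 / r) (n + 1)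
        = (r * n + 1) * Ring.multichoose (1 / r) n := by
      rw [mul_assoc, h]; field_simp; ring
    push_cast
    nlinarith

/-- The weight `(1 - t ^ r) ^ (1 / r - 1)` is integrable on `[0, 1]`. -/
lemma intervalIntegrable_one_sub_rpow {r : ℝ} (hr : 1 < r) :
    IntervalIntegrable (fun t : ℝ => (1 - t ^ r) ^ (1 / r - 1)) MeasureTheory.volume 0 1 := by
  have hr0 : 0 < r := by linarith
  have hb : IntervalIntegrable (fun t : ℝ => (1 - t) ^ (1 / r - 1)) MeasureTheory.volume 0 1 := by
    have := (intervalIntegral.intervalIntegrable_rpow' (a := 0) (b := 1) (r := 1 / r - 1)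
      (by have : 0 < 1 / r := by positivity
          linarith)).comp_sub_left 1
    simpa using this.symm
  refine hb.mono_fun ?_ ?_
  · exact (Measurable.pow_const
      (measurable_const.sub (measurable_id.pow_const r)) _).aestronglyMeasurable
  · refine (MeasureTheory.ae_restrict_iff' measurableSet_uIoc).2 (MeasureTheory.ae_of_all _ ?_)
    intro t ht
    rw [Set.uIoc_of_le zero_le_one] at ht
    have hexp : 1 / r - 1 < 0 := by rw [sub_neg, div_lt_one hr0]; exact hr
    rcases ht.2.eq_or_lt with rfl | h1
    · simp
    · have hle : t ^ r ≤ t := by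
        simpa using rpow_le_rpow_of_exponent_ge ht.1 ht.2 hr.le
      have : 0 < 1 - t := by linarith
      beta_reduce
      rw [norm_of_nonneg (rpow_nonneg (by linarith) _), norm_of_nonneg (rpow_nonneg this.le _)]
      exact rpow_le_rpow_of_nonpos this (by linarith) hexp.le

/-- The moment `∫₀¹ (1 - t ^ r) ^ (1 / r - 1) * t ^ (r n) dt`. -/
noncomputable def weightMoment (r : ℝ) (n : ℕ) : ℝ :=
  ∫ t in (0:ℝ)..1, (1 - t ^ r) ^ (1 / r - 1) * (t ^ r) ^ n

lemma weightMoment_succ {r : ℝ} (hr : 1 < r) (n : ℕ) :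
    (r * n + 2) * weightMoment r (n + 1) = (r * n + 1) * weightMoment r n := by
  have hr0 : 0 < r := by linarith
  have hint : ∀ m : ℕ, IntervalIntegrable
      (fun t : ℝ => (1 - t ^ r) ^ (1 / r - 1) * (t ^ r) ^ m) MeasureTheory.volume 0 1 := fun m =>
    (intervalIntegrable_one_sub_rpow hr).mul_continuousOn
      ((continuous_rpow_const hr0.le).pow m).continuousOn
  have key := intervalIntegral.integral_eq_sub_of_hasDerivAt_of_le (a := 0) (b := 1)
    (f := fun t : ℝ => t * (t ^ r) ^ n * (1 - t ^ r) ^ (1 / r))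
    (f' := fun t : ℝ => (r * n + 1) * ((1 - t ^ r) ^ (1 / r - 1) * (t ^ r) ^ n)
      - (r * n + 2) * ((1 - t ^ r) ^ (1 / r - 1) * (t ^ r) ^ (n + 1))) zero_le_one ?_ ?_
    (((hint n).const_mul _).sub ((hint (n + 1)).const_mul _))
  · rw [intervalIntegral.integral_sub ((hint n).const_mul _) ((hint (n + 1)).const_mul _),
      intervalIntegral.integral_const_mul, intervalIntegral.integral_const_mul] at key
    have h1 : (0:ℝ) ^ (1 / r) = 0 := zero_rpow (by positivity)
    simp only [one_rpow, sub_self, h1, mul_zero, zero_mul] at key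
    unfold weightMoment
    linarith
  · refine Continuous.continuousOn ?_
    have hc := continuous_rpow_const (q := r) hr0.le
    exact (continuous_id.mul (hc.pow n)).mul
      ((continuous_const.sub hc).rpow_const fun _ => Or.inr (by positivity))
  · intro t ht
    have ht1 : t ^ r < 1 := rpow_lt_one ht.1.le ht.2 hr0
    have hpos : 0 < 1 - t ^ r := by linarith
    have hA : HasDerivAt (fun t : ℝ => t ^ r) (r * t ^ (r - 1)) t :=
      hasDerivAt_rpow_const (Or.inl ht.1.ne')
    have hB := ((hasDerivAt_id t).mul (hA.pow n)).mul
      ((hA.const_sub 1).rpow_const (p := 1 / r) (Or.inl hpos.ne'))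
    have e1 : t * t ^ (r - 1) = t ^ r := by
      rw [rpow_sub_one ht.1.ne']; field_simp [ht.1.ne']
    have e2 : (1 - t ^ r) ^ (1 / r) = (1 - t ^ r) ^ (1 / r - 1) * (1 - t ^ r) := by
      rw [rpow_sub_one hpos.ne']; field_simp
    refine hB.congr_deriv ?_
    have e3 : t * ((n:ℝ) * (t ^ r) ^ (n - 1) * (r * t ^ (r - 1))) = r * n * (t ^ r) ^ n := by
      rcases n with _ | m
      · simp
      · rw [Nat.add_sub_cancel, pow_succ, ← e1]; ring
    have e4 : t * (t ^ r) ^ n * (-(r * t ^ (r - 1)) * (1 / r) * (1 - t ^ r) ^ (1 / r - 1))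
        = - ((t ^ r) ^ (n + 1) * (1 - t ^ r) ^ (1 / r - 1)) := by
      rw [pow_succ, ← e1]; field_simp
    simp only [id, Pi.mul_apply, Pi.pow_apply]
    rw [e3, e4, e2]
    ring

lemma weightMoment_zero_nonneg {r : ℝ} (hr : 1 < r) : 0 ≤ weightMoment r 0 := by
  refine intervalIntegral.integral_nonneg zero_le_one fun t ht => ?_
  have : t ^ r ≤ 1 := rpow_le_one ht.1 ht.2 (by linarith)
  have : 0 ≤ (1 - t ^ r) ^ (1 / r - 1) := rpow_nonneg (by linarith) _
  simpa

lemma weightMoment_zero_le {r : ℝ} (hr : 1 < r) (n : ℕ) :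
    weightMoment r 0 ≤ (r * n + 1) * weightMoment r n := by
  have h0 := weightMoment_zero_nonneg hr
  induction n with
  | zero => simp
  | succ n ih =>
    have h := weightMoment_succ hr n
    have hn : 0 ≤ r * n := by positivity
    have hM : 0 ≤ weightMoment r (n + 1) := by
      refine nonneg_of_mul_nonneg_right (a := r * n + 2) ?_ (by positivity)
      linarith
    push_cast
    nlinarith

/-- Upper bound for the products of binomial coefficients and normalized moments. -/
lemma multichoose_mul_weightMoment_le {r : ℝ} (hr : 1 < r) (n : ℕ) :
    (r * n + 1) * (Ring.multichoose (1 / r) n * weightMoment r n) ≤ weightMoment r 0 := by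
  have h0 := weightMoment_zero_nonneg hr
  have hr0 : 0 < r := by linarith
  induction n with
  | zero => simp
  | succ n ih =>
    have h := weightMoment_succ hr n
    have hc := succ_mul_multichoose_succ (1 / r) n
    have hrec : (r * (n + 1)) * Ring.multichoose (1 / r) (n + 1)
        = (r * n + 1) * Ring.multichoose (1 / r) n := by
      rw [mul_assoc, hc]; field_simp; ring
    have hn : 0 ≤ r * n := by positivity
    have hp : 0 < r * (n + 1) * (r * n + 2) := by positivity
    push_cast
    refine le_of_mul_le_mul_left ?_ hp
    calc r * (n + 1) * (r * n + 2) * ((r * (n + 1) + 1) *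
          (Ring.multichoose (1 / r) (n + 1) * weightMoment r (n + 1)))
        = (r * (n + 1) + 1) * ((r * (n + 1)) * Ring.multichoose (1 / r) (n + 1)) *
          ((r * n + 2) * weightMoment r (n + 1)) := by ring
      _ = (r * (n + 1) + 1) * (r * n + 1) *
          ((r * n + 1) * (Ring.multichoose (1 / r) n * weightMoment r n)) := by
        rw [hrec, h]; ring
      _ ≤ (r * (n + 1) + 1) * (r * n + 1) * weightMoment r 0 :=
        mul_le_mul_of_nonneg_left ih (by positivity)
      _ ≤ r * (n + 1) * (r * n + 2) * weightMoment r 0 :=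
        mul_le_mul_of_nonneg_right (by nlinarith) h0

lemma integral_rpow_pow {r : ℝ} (hr : 0 < r) (n : ℕ) :
    ∫ t in (0:ℝ)..1, (1:ℝ) * (t ^ r) ^ n = 1 / (r * n + 1) := by
  have hn : 0 ≤ r * n := by positivity
  have h : ∫ t in (0:ℝ)..1, (1:ℝ) * (t ^ r) ^ n = ∫ t in (0:ℝ)..1, t ^ (r * n) := by
    refine intervalIntegral.integral_congr fun t ht => ?_
    rw [Set.uIcc_of_le zero_le_one] at ht
    simp only [one_mul]
    rw [rpow_mul ht.1, rpow_natCast]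
  rw [h, integral_rpow (Or.inl (by linarith)), one_rpow, zero_rpow (by linarith)]
  simp

/-- Rescaling an integral over `[0, k]` to `[0, 1]`. -/
lemma integral_div_eq_integral_unit {r k : ℝ} (hk : 0 < k) (g : ℝ → ℝ) :
    (∫ s in (0:ℝ)..k, g (s ^ r)) / k = ∫ t in (0:ℝ)..1, (1:ℝ) * g (k ^ r * t ^ r) := by
  have h := intervalIntegral.integral_comp_mul_left (a := 0) (b := 1)
    (fun s : ℝ => g (s ^ r)) hk.ne'
  rw [mul_zero, mul_one, smul_eq_mul] at h
  rw [div_eq_inv_mul, ← h]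
  refine intervalIntegral.integral_congr fun t ht => ?_
  rw [Set.uIcc_of_le zero_le_one] at ht
  simp only [one_mul]
  rw [mul_rpow hk.le ht.1]

theorem stmt14 (r k : ℝ) (hr : 1 < r) (hk0 : 0 < k) (hk1 : k < 1) :
    piRR r / 2 * (arcsinR r k / k) ≤ Krr r k ∧
    Krr r k ≤ piRR r / 2 * (artanhR r k / k) ∧
    piRR r / 2 * (artanhR r k / k) ≤ piRR r / 2 * (1 - k ^ r) ^ (-(1 / r)) := by
  have hr0 : 0 < r := by linarith
  have hx0 : 0 < k ^ r := rpow_pos_of_pos hk0 r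
  have hx1 : k ^ r < 1 := rpow_lt_one hk0.le hk1 hr0
  have hexp : -(1 / (r / (r - 1))) = 1 / r - 1 := by
    have : r - 1 ≠ 0 := by linarith
    field_simp
    ring
  have hpi : piRR r / 2 = weightMoment r 0 := by
    simp only [piRR, weightMoment, hexp, pow_zero, mul_one]
    ring
  have hc0 : ∀ n, 0 ≤ Ring.multichoose (1 / r) n :=
    multichoose_nonneg_of_pos (by positivity)
  have hbin : ∀ y : ℝ, 0 ≤ y → y < 1 →
      HasSum (fun n => Ring.multichoose (1 / r) n * y ^ n) ((1 - y) ^ (-(1 / r))) :=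
    fun y hy0 hy1 => hasSum_multichoose_mul_pow (1 / r) hy0 hy1
  have hgeo : ∀ y : ℝ, 0 ≤ y → y < 1 → HasSum (fun n => (1:ℝ) * y ^ n) ((1 - y)⁻¹) :=
    fun y hy0 hy1 => by simpa using hasSum_geometric_of_lt_one hy0 hy1
  have hK := hasSum_integral_weight_mul_powerSeries hr0 hx0 hx1 hc0 hbin
    (intervalIntegrable_one_sub_rpow hr)
  have hS := hasSum_integral_weight_mul_powerSeries hr0 hx0 hx1 hc0 hbin
    (v := fun _ => 1) intervalIntegrable_const
  have hT := hasSum_integral_weight_mul_powerSeries hr0 hx0 hx1 (fun _ => zero_le_one) hgeo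
    (v := fun _ => 1) intervalIntegrable_const
  have hX := hbin _ hx0.le hx1
  rw [← integral_div_eq_integral_unit hk0 (fun y => (1 - y) ^ (-(1 / r)))] at hS
  rw [← integral_div_eq_integral_unit hk0 (fun y => (1 - y)⁻¹)] at hT
  simp only [integral_rpow_pow hr0] at hS hT
  rw [← hexp] at hK
  change HasSum _ (Krr r k) at hK
  rw [hexp] at hK
  change HasSum (fun n => _ * weightMoment r n) _ at hK
  change HasSum _ (arcsinR r k / k) at hS
  change HasSum _ (artanhR r k / k) at hT
  have hM0 := weightMoment_zero_nonneg hr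
  have hden : ∀ n : ℕ, 0 < r * n + 1 := fun n => by positivity
  have hxn : ∀ n : ℕ, 0 ≤ (k ^ r) ^ n := fun n => pow_nonneg hx0.le n
  rw [hpi]
  refine ⟨hasSum_le (fun n => ?_) (hS.mul_left _) hK, hasSum_le (fun n => ?_) hK (hT.mul_left _),
    mul_le_mul_of_nonneg_left (hasSum_le (fun n => ?_) hT hX) hM0⟩
  · have h : weightMoment r 0 * (1 / (r * n + 1)) ≤ weightMoment r n := by
      rw [mul_one_div, div_le_iff₀' (hden n)]
      exact weightMoment_zero_le hr n
    have := mul_le_mul_of_nonneg_left h (mul_nonneg (hc0 n) (hxn n))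
    linarith
  · have h : Ring.multichoose (1 / r) n * weightMoment r n
        ≤ weightMoment r 0 * (1 / (r * n + 1)) := by
      rw [mul_one_div, le_div_iff₀' (hden n)]
      exact multichoose_mul_weightMoment_le hr n
    have := mul_le_mul_of_nonneg_left h (hxn n)
    linarith
  · have h : 1 / (r * n + 1) ≤ Ring.multichoose (1 / r) n := by
      rw [div_le_iff₀' (hden n)]
      exact one_le_mul_multichoose hr n
    have := mul_le_mul_of_nonneg_left h (hxn n)
    linarith
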